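/- There is an absolute constant c₀ ≥ 1 such that for every real c ≥ c₀ there is a constant C = C(c) > 0 with: for every integer m ≥ 16, every integer n ≤ m with ε := 1 − n/m satisfying 0 < ε ≤ 1/c, and every array configuration A on m slots with n elements, (1/|J|)·Σ_{j ∈ J} Δ_j(A) ≤ C·ε/√(log₂ n). -/

import Mathlib

open scoped BigOperators Classical

/-- Read slot `i` (mod `m`) of a cyclic array of `m` boolean slots. -/
def cyc (m : ℕ) (A : Fin m → Bool) (i : ℕ) : Bool :=
  if h : 0 < m then A ⟨i % m, Nat.mod_lt i h⟩ else false

/-- Number of occupied slots among the `j` cyclically consecutive slots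
`p, p+1, …, p+j-1`. -/
def blockCount (m : ℕ) (A : Fin m → Bool) (p j : ℕ) : ℕ :=
  ((Finset.range j).filter (fun t => cyc m A (p + t) = true)).card

/-- Density of the `j`-block starting at slot `p`. -/
noncomputable def blockDensity (m : ℕ) (A : Fin m → Bool) (p j : ℕ) : ℝ :=
  (blockCount m A p j : ℝ) / j

/-- A block is live (w.r.t. constant `c` and sparsity `ε`) if its density is
at least `1 - c·ε`. -/
def IsLive (c ε : ℝ) (m : ℕ) (A : Fin m → Bool) (p j : ℕ) : Prop :=
  1 - c * ε ≤ blockDensity m A p j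

/-- Imbalance of a `j`-block (for even `j`): difference of the densities of its
two halves. -/
noncomputable def imbalance (m : ℕ) (A : Fin m → Bool) (p j : ℕ) : ℝ :=
  |blockDensity m A p (j / 2) - blockDensity m A (p + j / 2) (j / 2)|

/-- Adjusted imbalance: the imbalance if the block is live, `0` if it is dead. -/
noncomputable def adjImbalance (c ε : ℝ) (m : ℕ) (A : Fin m → Bool) (p j : ℕ) : ℝ :=
  if IsLive c ε m A p j then imbalance m A p j else 0

/-- `Δ_j(A)`: the average adjusted imbalance over all `m` `j`-blocks. -/
noncomputable def DeltaAvg (c ε : ℝ) (m : ℕ) (A : Fin m → Bool) (j : ℕ) : ℝ :=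
  (∑ p ∈ Finset.range m, adjImbalance c ε m A p j) / m

/-- `J = {2, 4, 8, …, 2^(⌊log₂ m⌋ - 2)}`. -/
def Jset (m : ℕ) : Finset ℕ := (Finset.Icc 1 (Nat.log 2 m - 2)).image (fun i => 2 ^ i)

/-- The potential `φ` of a `j`-block: `0` if dead, `(μ - (1 - c·ε))²` if live,
where `μ` is its density. -/
noncomputable def potential (c ε : ℝ) (m : ℕ) (A : Fin m → Bool) (p j : ℕ) : ℝ :=
  if IsLive c ε m A p j then (blockDensity m A p j - (1 - c * ε)) ^ 2 else 0


noncomputable def posSq (x : ℝ) : ℝ := (max x 0) ^ 2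

lemma posSq_half (x y : ℝ) :
    (if 0 ≤ (x + y) / 2 then |x - y| else 0) ^ 2 ≤
      16 * ((posSq x + posSq y) / 2 - posSq ((x + y) / 2)) := by
  unfold posSq
  split_ifs with h
  · rw [sq_abs, max_eq_left h]
    rcases le_total 0 x with hx | hx <;> rcases le_total 0 y with hy | hy
    · rw [max_eq_left hx, max_eq_left hy]; nlinarith [sq_nonneg (x - y)]
    · rw [max_eq_left hx, max_eq_right hy]
      nlinarith [mul_nonneg hx (neg_nonneg.2 hy), mul_nonneg (by linarith : 0 ≤ x + y) hx,
        mul_nonneg (by linarith : 0 ≤ x + y) (neg_nonneg.2 hy)]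
    · rw [max_eq_right hx, max_eq_left hy]
      nlinarith [mul_nonneg hy (neg_nonneg.2 hx), mul_nonneg (by linarith : 0 ≤ x + y) hy,
        mul_nonneg (by linarith : 0 ≤ x + y) (neg_nonneg.2 hx)]
    · rw [max_eq_right hx, max_eq_right hy]
      have : x = 0 := by linarith
      have : y = 0 := by linarith
      subst_vars; norm_num
  · rw [max_eq_right (not_le.1 h).le]
    nlinarith [sq_nonneg (max x 0), sq_nonneg (max y 0)]

lemma blockCount_add (m : ℕ) (A : Fin m → Bool) (p h k : ℕ) :
    blockCount m A p (h + k) = blockCount m A p h + blockCount m A (p + h) k := by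
  unfold blockCount
  simp only [Finset.card_filter]
  rw [Finset.sum_range_add]
  simp only [add_assoc]

lemma blockDensity_double (m : ℕ) (A : Fin m → Bool) (p h : ℕ) :
    blockDensity m A p (2 * h) =
      (blockDensity m A p h + blockDensity m A (p + h) h) / 2 := by
  unfold blockDensity
  rw [two_mul, blockCount_add]
  rcases Nat.eq_zero_or_pos h with rfl | hh
  · simp
  · have : (h : ℝ) ≠ 0 := by positivity
    push_cast
    field_simp
    ring

lemma cyc_add (m : ℕ) (A : Fin m → Bool) (i : ℕ) : cyc m A (i + m) = cyc m A i := by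
  simp [cyc]

lemma blockDensity_add (m : ℕ) (A : Fin m → Bool) (p h : ℕ) :
    blockDensity m A (p + m) h = blockDensity m A p h := by
  unfold blockDensity blockCount
  have : ∀ t, p + m + t = p + t + m := fun t => by omega
  simp only [this, cyc_add]

lemma sum_shift (m : ℕ) (g : ℕ → ℝ) (hg : ∀ p, g (p + m) = g p) (h : ℕ) :
    ∑ p ∈ Finset.range m, g (p + h) = ∑ p ∈ Finset.range m, g p := by
  induction h with
  | zero => simp
  | succ k ih =>
    rw [← ih]
    have h1 := Finset.sum_range_succ (fun p => g (p + k)) m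
    have h2 := Finset.sum_range_succ' (fun p => g (p + k)) m
    have h3 : g (m + k) = g (0 + k) := by rw [add_comm m k, hg, zero_add]
    have h4 : ∀ p, p + 1 + k = p + (k + 1) := fun p => by omega
    simp only [h4] at h2
    linarith

noncomputable def Phi (t : ℝ) (m : ℕ) (A : Fin m → Bool) (i : ℕ) : ℝ :=
  ∑ p ∈ Finset.range m, posSq (blockDensity m A p (2 ^ i) - t)

lemma adj_step (c ε : ℝ) (m : ℕ) (A : Fin m → Bool) (i : ℕ) :
    ∑ p ∈ Finset.range m, (adjImbalance c ε m A p (2 ^ (i + 1))) ^ 2 ≤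
      16 * (Phi (1 - c * ε) m A i - Phi (1 - c * ε) m A (i + 1)) := by
  set t := 1 - c * ε with ht
  have hs := sum_shift m (fun p => posSq (blockDensity m A p (2 ^ i) - t))
    (fun p => by simp only [blockDensity_add]) (2 ^ i)
  have key : ∀ p ∈ Finset.range m, (adjImbalance c ε m A p (2 ^ (i + 1))) ^ 2 ≤
      16 * ((posSq (blockDensity m A p (2 ^ i) - t)
        + posSq (blockDensity m A (p + 2 ^ i) (2 ^ i) - t)) / 2
        - posSq (blockDensity m A p (2 ^ (i + 1)) - t)) := by
    intro p _
    have e : 2 ^ (i + 1) = 2 * 2 ^ i := by ring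
    have h := posSq_half (blockDensity m A p (2 ^ i) - t)
      (blockDensity m A (p + 2 ^ i) (2 ^ i) - t)
    have e2 : (blockDensity m A p (2 ^ i) - t + (blockDensity m A (p + 2 ^ i) (2 ^ i) - t)) / 2
        = blockDensity m A p (2 ^ (i + 1)) - t := by
      rw [e, blockDensity_double]; ring
    rw [e2] at h
    refine le_trans (le_of_eq ?_) h
    unfold adjImbalance IsLive imbalance
    have e3 : 2 ^ (i + 1) / 2 = 2 ^ i := by omega
    rw [e3]
    simp only [sub_nonneg, sub_sub_sub_cancel_right, ← ht]
  refine (Finset.sum_le_sum key).trans (le_of_eq ?_)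
  unfold Phi
  rw [← Finset.mul_sum, Finset.sum_sub_distrib, ← Finset.sum_div, Finset.sum_add_distrib, hs]
  ring

lemma adj_total (c ε : ℝ) (m : ℕ) (A : Fin m → Bool) (K : ℕ) :
    ∑ i ∈ Finset.range K, ∑ p ∈ Finset.range m, (adjImbalance c ε m A p (2 ^ (i + 1))) ^ 2 ≤
      16 * (Phi (1 - c * ε) m A 0 - Phi (1 - c * ε) m A K) := by
  induction K with
  | zero => simp
  | succ K ih =>
    rw [Finset.sum_range_succ]
    have := adj_step c ε m A K
    linarith

lemma Phi_nonneg (t : ℝ) (m : ℕ) (A : Fin m → Bool) (i : ℕ) : 0 ≤ Phi t m A i :=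
  Finset.sum_nonneg fun _ _ => sq_nonneg _

lemma Phi_zero_le (c ε : ℝ) (hce : 0 ≤ c * ε) (m : ℕ) (A : Fin m → Bool) :
    Phi (1 - c * ε) m A 0 ≤ m * (c * ε) ^ 2 := by
  unfold Phi
  refine (Finset.sum_le_card_nsmul _ _ ((c * ε) ^ 2) ?_).trans (by simp)
  intro p _
  unfold posSq
  have h1 : blockDensity m A p (2 ^ 0) ≤ 1 := by
    unfold blockDensity blockCount
    have : ((Finset.range (2 ^ 0)).filter (fun t => cyc m A (p + t) = true)).card ≤ 1 := by
      exact (Finset.card_filter_le _ _).trans (by simp)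
    have : (((Finset.range (2 ^ 0)).filter (fun t => cyc m A (p + t) = true)).card : ℝ) ≤ 1 := by
      exact_mod_cast this
    simpa using this
  apply pow_le_pow_left₀ (le_max_right _ _)
  exact max_le (by linarith) hce

lemma Jset_sum (m : ℕ) (g : ℕ → ℝ) :
    ∑ j ∈ Jset m, g j = ∑ i ∈ Finset.range (Nat.log 2 m - 2), g (2 ^ (i + 1)) := by
  unfold Jset
  rw [Finset.sum_image (fun a _ b _ h => Nat.pow_right_injective le_rfl h),
    Finset.range_eq_Ico, Finset.sum_Ico_add' (fun i => g (2 ^ i)) 0 _ 1]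
  rfl

lemma Jset_card (m : ℕ) : (Jset m).card = Nat.log 2 m - 2 := by
  unfold Jset
  rw [Finset.card_image_of_injective _ (Nat.pow_right_injective le_rfl)]
  simp

theorem statement11 :
    ∃ c₀ : ℝ, 1 ≤ c₀ ∧
      ∀ c : ℝ, c₀ ≤ c → ∃ C : ℝ, 0 < C ∧
      ∀ m : ℕ, 16 ≤ m → ∀ n : ℕ, n ≤ m →
      0 < 1 - (n : ℝ) / m → 1 - (n : ℝ) / m ≤ 1 / c →
      ∀ A : Fin m → Bool, (Finset.univ.filter (fun i => A i = true)).card = n →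
      (1 / ((Jset m).card : ℝ)) * ∑ j ∈ Jset m, DeltaAvg c (1 - (n : ℝ) / m) m A j
        ≤ C * (1 - (n : ℝ) / m) / Real.sqrt (Real.logb 2 n) := by
  refine ⟨2, by norm_num, fun c hc => ⟨8 * c, by linarith, ?_⟩⟩
  intro m hm n hnm hε0 hε1 A _
  set ε : ℝ := 1 - (n : ℝ) / m with hε
  have hmpos : (0 : ℝ) < m := by exact_mod_cast (by omega : 0 < m)
  have hlog : 4 ≤ Nat.log 2 m := Nat.le_log_of_pow_le (by norm_num) (by omega)
  have hn8 : (8 : ℝ) ≤ n := by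
    have h1 : 1 / c ≤ 1 / 2 := one_div_le_one_div_of_le (by norm_num) hc
    have h2 : (1 : ℝ) / 2 ≤ n / m := by linarith
    rw [le_div_iff₀ hmpos] at h2
    have : (16 : ℝ) ≤ m := by exact_mod_cast hm
    linarith
  have hL0 : 0 < Real.logb 2 n := Real.logb_pos (by norm_num) (by linarith)
  have hL1 : Real.logb 2 n ≤ Nat.log 2 m + 1 := by
    rw [Real.logb_le_iff_le_rpow (by norm_num) (by linarith)]
    have h1 : m < 2 ^ (Nat.log 2 m + 1) := Nat.lt_pow_succ_log_self (by norm_num) m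
    have h2 : (n : ℝ) ≤ 2 ^ (Nat.log 2 m + 1) := by exact_mod_cast hnm.trans h1.le
    exact_mod_cast h2
  rw [Jset_card, Jset_sum]
  set K := Nat.log 2 m - 2 with hK
  have hKL : Real.logb 2 n ≤ 4 * K := by
    have : Nat.log 2 m + 1 ≤ 4 * K := by omega
    have : (Nat.log 2 m : ℝ) + 1 ≤ 4 * K := by exact_mod_cast this
    linarith
  have hKpos : (0 : ℝ) < K := by linarith
  have hce : 0 ≤ c * ε := mul_nonneg (by linarith) hε0.le
  have htot := adj_total c ε m A K
  have hP0 := Phi_zero_le c ε hce m A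
  have hPK := Phi_nonneg (1 - c * ε) m A K
  unfold DeltaAvg
  rw [← Finset.sum_div]
  set S := ∑ i ∈ Finset.range K, ∑ p ∈ Finset.range m, adjImbalance c ε m A p (2 ^ (i + 1)) with hS
  have hCS : S ^ 2 ≤ (K * m) * (16 * (m * (c * ε) ^ 2)) := by
    have h := sq_sum_le_card_mul_sum_sq (s := Finset.range K ×ˢ Finset.range m)
      (f := fun x => adjImbalance c ε m A x.2 (2 ^ (x.1 + 1)))
    rw [Finset.sum_product, Finset.sum_product] at h
    simp only [Finset.card_product, Finset.card_range, Nat.cast_mul] at h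
    refine h.trans (mul_le_mul_of_nonneg_left ?_ (by positivity))
    linarith
  rw [le_div_iff₀ (Real.sqrt_pos.2 hL0)]
  refine le_of_abs_le (abs_le_of_sq_le_sq ?_ (by linarith))
  rw [mul_pow, Real.sq_sqrt hL0.le]
  have e : (1 / (K : ℝ) * (S / m)) ^ 2 = S ^ 2 / (K * m) ^ 2 := by
    field_simp
  rw [e, div_mul_eq_mul_div, div_le_iff₀ (by positivity)]
  calc S ^ 2 * Real.logb 2 n ≤ ((K * m) * (16 * (m * (c * ε) ^ 2))) * (4 * K) := by gcongr
    _ = (8 * c * ε) ^ 2 * (K * m) ^ 2 := by ring
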